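/- Let d ≥ 1 and let μ ∈ P_1(ℝ^d) be centered. Then the following are equivalent: (i) there exists c > 0 such that T(ρ,μ) ≥ c · ∫|x| dρ(x) for every centered ρ ∈ P_1(ℝ^d); (ii) μ is not supported on an affine hyperplane, i.e. there is no e ∈ ℝ^d with |e| = 1 and ℓ ∈ ℝ such that μ({y : ⟨y,e⟩ = ℓ}) = 1. In particular, if μ is centered and supported on an affine hyperplane, then there exists a centered ρ ∈ P_1(ℝ^d) with ∫|x| dρ(x) > 0 and T(ρ,μ) = 0. -/

import Mathlib

open MeasureTheory Real Filter Topology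
open scoped ENNReal RealInnerProductSpace

noncomputable section

/-- `d`-dimensional Euclidean space. -/
abbrev Ed (d : ℕ) := EuclideanSpace ℝ (Fin d)

open Classical in
/-- The entropy `E(ρ) = ∫ f ln f dx` (extended-real-valued, computed as positive part minus
negative part of the integral of `f ln f`, where `f` is the density), and `+∞` if `ρ` is not
absolutely continuous w.r.t. Lebesgue measure. -/
def entropy {d : ℕ} (ρ : Measure (Ed d)) : EReal :=
  if ρ ≪ (volume : Measure (Ed d)) then
    ((∫⁻ x, ENNReal.ofReal ((ρ.rnDeriv volume x).toReal *
        Real.log (ρ.rnDeriv volume x).toReal) : ℝ≥0∞) : EReal)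
      - ((∫⁻ x, ENNReal.ofReal (-((ρ.rnDeriv volume x).toReal *
        Real.log (ρ.rnDeriv volume x).toReal)) : ℝ≥0∞) : EReal)
  else ⊤

/-- The (extended-real-valued) integral `∫ ⟨x,y⟩ dγ(x,y)`: positive part minus negative part. -/
def pairInt {d : ℕ} (γ : Measure (Ed d × Ed d)) : EReal :=
  ((∫⁻ p, ENNReal.ofReal (⟪p.1, p.2⟫ : ℝ) ∂γ : ℝ≥0∞) : EReal)
    - ((∫⁻ p, ENNReal.ofReal (-(⟪p.1, p.2⟫ : ℝ)) ∂γ : ℝ≥0∞) : EReal)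

/-- Transport plans: probability measures on the product with marginals `ρ` and `μ`. -/
def Couplings {d : ℕ} (ρ μ : Measure (Ed d)) : Set (Measure (Ed d × Ed d)) :=
  {γ | IsProbabilityMeasure γ ∧ γ.fst = ρ ∧ γ.snd = μ}

/-- The maximal correlation functional `T(ρ,μ) = sup { ∫⟨x,y⟩ dγ : γ ∈ Π(ρ,μ) }`. -/
def maxCorr {d : ℕ} (ρ μ : Measure (Ed d)) : EReal :=
  ⨆ γ ∈ Couplings ρ μ, pairInt γ

/-- `ρ` has finite first moment. -/
def FirstMoment {d : ℕ} (ρ : Measure (Ed d)) : Prop := Integrable (fun x => ‖x‖) ρ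

/-- `ρ` is centered: its barycenter is `0`. -/
def Centered {d : ℕ} (ρ : Measure (Ed d)) : Prop := (∫ x, x ∂ρ) = 0

/-- Weak convergence of measures: convergence of integrals of bounded continuous functions. -/
def WeakConv {d : ℕ} (ρs : ℕ → Measure (Ed d)) (ρ : Measure (Ed d)) : Prop :=
  ∀ f : BoundedContinuousFunction (Ed d) ℝ,
    Tendsto (fun n => ∫ x, f x ∂(ρs n)) atTop (𝓝 (∫ x, f x ∂ρ))

/-- Convexity for extended-real-valued functions on `Ed d`. -/
def EConvexOn {d : ℕ} (u : Ed d → EReal) : Prop :=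
  ∀ x y : Ed d, ∀ a b : ℝ, 0 ≤ a → 0 ≤ b → a + b = 1 →
    u (a • x + b • y) ≤ (a : EReal) * u x + (b : EReal) * u y

/-- `e^{-t}` for `t ∈ ℝ ∪ {+∞}`, with `e^{-∞} = 0`. -/
def expNegE (t : EReal) : ℝ := if t = ⊤ then 0 else Real.exp (-t.toReal)

/-- The Legendre transform `u*(y) = sup_x (⟨x,y⟩ - u(x))`. -/
def legendre {d : ℕ} (u : Ed d → EReal) (y : Ed d) : EReal :=
  ⨆ x : Ed d, (((⟪x, y⟫ : ℝ) : EReal) - u x)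

/-- The essential continuity of a convex l.s.c. function `u : ℝ^d → ℝ ∪ {+∞}`:
`u` tends to `+∞` at `H^{d-1}`-a.e. point of the boundary of its domain. -/
def EssentiallyContinuous {d : ℕ} (u : Ed d → EReal) : Prop :=
  μH[(d : ℝ) - 1] {x : Ed d | x ∈ frontier {y | u y < ⊤} ∧ u x < ⊤} = 0

lemma FirstMoment.integrable_id {d : ℕ} {ρ : Measure (Ed d)} (h : FirstMoment ρ) :
    Integrable (fun x : Ed d => x) ρ :=
  (integrable_norm_iff measurable_id.aestronglyMeasurable).mp h

lemma FirstMoment.integrable_smul_id {d : ℕ} {ρ : Measure (Ed d)} (h : FirstMoment ρ)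
    {f : Ed d → ℝ} (hf : Measurable f) (hf1 : ∀ x, |f x| ≤ 1) :
    Integrable (fun x => f x • x) ρ :=
  h.integrable_id.bdd_smul 1 hf.aestronglyMeasurable (ae_of_all _ hf1)

lemma integrable_of_abs_le_one {d : ℕ} {ρ : Measure (Ed d)} [IsProbabilityMeasure ρ]
    {f : Ed d → ℝ} (hf : Measurable f) (hf1 : ∀ x, |f x| ≤ 1) : Integrable f ρ :=
  Integrable.of_bound hf.aestronglyMeasurable 1 (ae_of_all _ hf1)

lemma pairInt_eq_integral {d : ℕ} {γ : Measure (Ed d × Ed d)}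
    (hγ : Integrable (fun p : Ed d × Ed d => (⟪p.1, p.2⟫ : ℝ)) γ) :
    pairInt γ = ((∫ p, (⟪p.1, p.2⟫ : ℝ) ∂γ : ℝ) : EReal) := by
  have h1 : ∫⁻ p, ENNReal.ofReal (⟪p.1, p.2⟫ : ℝ) ∂γ ≠ ⊤ := hγ.lintegral_lt_top.ne
  have h2 : ∫⁻ p, ENNReal.ofReal (-(⟪p.1, p.2⟫ : ℝ)) ∂γ ≠ ⊤ := hγ.neg.lintegral_lt_top.ne
  rw [integral_eq_lintegral_pos_part_sub_lintegral_neg_part hγ, EReal.coe_sub,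
    EReal.coe_ennreal_toReal h1, EReal.coe_ennreal_toReal h2]
  rfl

lemma lintegral_ofReal_one_add_mul {d : ℕ} {μ : Measure (Ed d)} [IsProbabilityMeasure μ]
    {g : Ed d → ℝ} (hg : Measurable g) (hg1 : ∀ y, |g y| ≤ 1) (hg0 : ∫ y, g y ∂μ = 0)
    {a : ℝ} (ha : |a| ≤ 1) : ∫⁻ y, ENNReal.ofReal (1 + a * g y) ∂μ = 1 := by
  have hint := integrable_of_abs_le_one (ρ := μ) hg hg1
  have hadd : Integrable (fun y => 1 + a * g y) μ := (integrable_const _).add (hint.const_mul a)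
  rw [← ofReal_integral_eq_lintegral_ofReal hadd, integral_add (integrable_const _) (hint.const_mul a), integral_const_mul, hg0]
  · simp
  · refine ae_of_all _ fun y => ?_
    have h := mul_le_one₀ ha (abs_nonneg _) (hg1 y)
    rw [← abs_mul] at h
    simp only [Pi.zero_apply]
    linarith [(abs_le.mp h).1]

/-- The product coupling reweighted by the density `1 + f(x) g(y)`. -/
def tiltedProd {d : ℕ} (ρ μ : Measure (Ed d)) (f g : Ed d → ℝ) : Measure (Ed d × Ed d) :=
  (ρ.prod μ).withDensity fun p => ENNReal.ofReal (1 + f p.1 * g p.2)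

lemma tiltedProd_mem_couplings {d : ℕ} {ρ μ : Measure (Ed d)}
    [IsProbabilityMeasure ρ] [IsProbabilityMeasure μ] {f g : Ed d → ℝ}
    (hf : Measurable f) (hf1 : ∀ x, |f x| ≤ 1) (hf0 : ∫ x, f x ∂ρ = 0)
    (hg : Measurable g) (hg1 : ∀ y, |g y| ≤ 1) (hg0 : ∫ y, g y ∂μ = 0) :
    tiltedProd ρ μ f g ∈ Couplings ρ μ := by
  have hD : Measurable fun p : Ed d × Ed d => ENNReal.ofReal (1 + f p.1 * g p.2) := by fun_prop
  have hfst : (tiltedProd ρ μ f g).fst = ρ := by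
    ext s hs
    rw [Measure.fst_apply hs, tiltedProd, withDensity_apply _ (measurable_fst hs),
      ← Set.prod_univ, ← Measure.prod_restrict, lintegral_prod _ hD.aemeasurable]
    simp [lintegral_ofReal_one_add_mul hg hg1 hg0 (hf1 _)]
  have hsnd : (tiltedProd ρ μ f g).snd = μ := by
    ext s hs
    rw [Measure.snd_apply hs, tiltedProd, withDensity_apply _ (measurable_snd hs),
      ← Set.univ_prod, ← Measure.prod_restrict, lintegral_prod_symm _ hD.aemeasurable]
    simp_rw [mul_comm (f _)]
    simp [lintegral_ofReal_one_add_mul hf hf1 hf0 (hg1 _)]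
  refine ⟨⟨?_⟩, hfst, hsnd⟩
  rw [← Measure.fst_univ, hfst, measure_univ]

lemma integrable_inner_prod {d : ℕ} {ρ μ : Measure (Ed d)} [SFinite ρ] [SFinite μ]
    (hρ1 : FirstMoment ρ) (hμ1 : FirstMoment μ) :
    Integrable (fun p : Ed d × Ed d => (⟪p.1, p.2⟫ : ℝ)) (ρ.prod μ) := by
  refine (Integrable.mul_prod hρ1 hμ1).mono' (by fun_prop) (ae_of_all _ fun p => ?_)
  exact norm_inner_le_norm _ _

lemma integral_inner_one_add_mul {d : ℕ} {ρ μ : Measure (Ed d)}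
    [IsProbabilityMeasure ρ] [IsProbabilityMeasure μ]
    (hρ1 : FirstMoment ρ) (hμ1 : FirstMoment μ) (hμc : Centered μ) {f g : Ed d → ℝ}
    (hf : Measurable f) (hf1 : ∀ x, |f x| ≤ 1) (hg : Measurable g) (hg1 : ∀ y, |g y| ≤ 1)
    (hint : Integrable (fun p : Ed d × Ed d => (1 + f p.1 * g p.2) * (⟪p.1, p.2⟫ : ℝ))
      (ρ.prod μ)) :
    ∫ p, (1 + f p.1 * g p.2) * (⟪p.1, p.2⟫ : ℝ) ∂(ρ.prod μ) =
      ⟪∫ x, f x • x ∂ρ, ∫ y, g y • y ∂μ⟫ := by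
  have hinner (x : Ed d) : ∫ y, (1 + f x * g y) * (⟪x, y⟫ : ℝ) ∂μ =
      ⟪∫ y, g y • y ∂μ, f x • x⟫ := by
    have hgi : Integrable (fun y => f x • g y • y) μ :=
      (hμ1.integrable_smul_id hg hg1).smul (f x)
    calc ∫ y, (1 + f x * g y) * (⟪x, y⟫ : ℝ) ∂μ
        = ∫ y, (⟪x, y + f x • g y • y⟫ : ℝ) ∂μ := by
          refine integral_congr_ae (ae_of_all _ fun y => ?_)
          simp only [inner_add_right, inner_smul_right]
          ring
      _ = ⟪x, ∫ y, (y + f x • g y • y) ∂μ⟫ :=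
          integral_inner (hμ1.integrable_id.add hgi) x
      _ = _ := by
          rw [integral_add hμ1.integrable_id hgi, integral_smul,
            show ∫ y, y ∂μ = 0 from hμc, zero_add, inner_smul_right, inner_smul_right,
            real_inner_comm]
  rw [integral_prod _ hint]
  simp only [hinner]
  rw [integral_inner (hρ1.integrable_smul_id hf hf1), real_inner_comm]

lemma coe_inner_le_maxCorr {d : ℕ} {ρ μ : Measure (Ed d)}
    [IsProbabilityMeasure ρ] [IsProbabilityMeasure μ]
    (hρ1 : FirstMoment ρ) (hμ1 : FirstMoment μ) (hμc : Centered μ) {f g : Ed d → ℝ}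
    (hf : Measurable f) (hf1 : ∀ x, |f x| ≤ 1) (hf0 : ∫ x, f x ∂ρ = 0)
    (hg : Measurable g) (hg1 : ∀ y, |g y| ≤ 1) (hg0 : ∫ y, g y ∂μ = 0) :
    ((⟪∫ x, f x • x ∂ρ, ∫ y, g y • y ∂μ⟫ : ℝ) : EReal) ≤ maxCorr ρ μ := by
  have hmul (p : Ed d × Ed d) : |f p.1 * g p.2| ≤ 1 := by
    rw [abs_mul]
    exact mul_le_one₀ (hf1 _) (abs_nonneg _) (hg1 _)
  have hD : Measurable fun p : Ed d × Ed d => ENNReal.ofReal (1 + f p.1 * g p.2) := by fun_prop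
  have hDtop : ∀ᵐ p ∂(ρ.prod μ), ENNReal.ofReal (1 + f p.1 * g p.2) < ∞ :=
    ae_of_all _ fun _ => ENNReal.ofReal_lt_top
  have htoReal (p : Ed d × Ed d) :
      (ENNReal.ofReal (1 + f p.1 * g p.2)).toReal = 1 + f p.1 * g p.2 :=
    ENNReal.toReal_ofReal (by linarith [(abs_le.mp (hmul p)).1])
  have hint : Integrable (fun p : Ed d × Ed d => (1 + f p.1 * g p.2) * (⟪p.1, p.2⟫ : ℝ))
      (ρ.prod μ) := by
    refine (integrable_inner_prod hρ1 hμ1).bdd_mul (c := 2) (by fun_prop)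
      (ae_of_all _ fun p => ?_)
    have h := abs_le.mp (hmul p)
    exact abs_le.mpr ⟨by linarith, by linarith⟩
  have hγ : Integrable (fun p : Ed d × Ed d => (⟪p.1, p.2⟫ : ℝ)) (tiltedProd ρ μ f g) := by
    rw [tiltedProd, integrable_withDensity_iff_integrable_smul' hD hDtop]
    simpa only [htoReal, smul_eq_mul] using hint
  have hval : pairInt (tiltedProd ρ μ f g) =
      ((⟪∫ x, f x • x ∂ρ, ∫ y, g y • y ∂μ⟫ : ℝ) : EReal) := by
    rw [pairInt_eq_integral hγ, tiltedProd,
      integral_withDensity_eq_integral_toReal_smul hD hDtop]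
    simp only [htoReal, smul_eq_mul]
    rw [integral_inner_one_add_mul hρ1 hμ1 hμc hf hf1 hg hg1 hint]
  rw [← hval]
  exact le_iSup₂ (f := fun γ (_ : γ ∈ Couplings ρ μ) => pairInt γ) _
    (tiltedProd_mem_couplings hf hf1 hf0 hg hg1 hg0)

lemma exists_tilt_inner_eq {d : ℕ} {ρ : Measure (Ed d)} [IsProbabilityMeasure ρ]
    (hρ1 : FirstMoment ρ) (hρc : Centered ρ) (e : Ed d) :
    ∃ f : Ed d → ℝ, Measurable f ∧ (∀ x, |f x| ≤ 1) ∧ ∫ x, f x ∂ρ = 0 ∧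
      ⟪e, ∫ x, f x • x ∂ρ⟫ = (∫ x, |(⟪e, x⟫ : ℝ)| ∂ρ) / 2 := by
  set s : Ed d → ℝ := fun x => if 0 ≤ (⟪e, x⟫ : ℝ) then 1 else -1 with hs
  have hsm : Measurable s :=
    Measurable.ite (measurableSet_le measurable_const (by fun_prop)) measurable_const
      measurable_const
  have hs1 (x : Ed d) : |s x| ≤ 1 := by
    simp only [hs]
    split_ifs <;> simp
  have hsi := integrable_of_abs_le_one (ρ := ρ) hsm hs1
  have hS : |∫ x, s x ∂ρ| ≤ 1 := by
    simpa using norm_integral_le_of_norm_le_const (μ := ρ) (f := s) (ae_of_all _ hs1)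
  refine ⟨fun x => (s x - ∫ z, s z ∂ρ) / 2, by fun_prop, fun x => ?_, ?_, ?_⟩
  · have h1 := abs_le.mp (hs1 x)
    have h2 := abs_le.mp hS
    exact abs_le.mpr ⟨by linarith, by linarith⟩
  · rw [integral_div, integral_sub hsi (integrable_const _)]
    simp
  · have hsx := hρ1.integrable_smul_id hsm hs1
    have hSx : Integrable (fun x : Ed d => (∫ z, s z ∂ρ) • x) ρ :=
      hρ1.integrable_id.smul (∫ z, s z ∂ρ)
    have heq (x : Ed d) : ((s x - ∫ z, s z ∂ρ) / 2) • x =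
        (1 / 2 : ℝ) • (s x • x - (∫ z, s z ∂ρ) • x) := by
      module
    simp only [heq]
    rw [integral_smul, integral_sub hsx hSx, integral_smul,
      show ∫ x, x ∂ρ = 0 from hρc, smul_zero, sub_zero, inner_smul_right,
      ← integral_inner hsx, one_div, inv_mul_eq_div]
    congr 2
    ext x
    rw [inner_smul_right]
    simp only [hs]
    split_ifs with h
    · rw [one_mul, abs_of_nonneg h]
    · rw [neg_one_mul, abs_of_neg (not_le.mp h)]

lemma exists_pos_mul_norm_le_integral_abs_inner {d : ℕ} (hd : 1 ≤ d) {μ : Measure (Ed d)}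
    [IsProbabilityMeasure μ] (hμ1 : FirstMoment μ)
    (hμ : ¬ ∃ e : Ed d, ∃ ℓ : ℝ, ‖e‖ = 1 ∧ μ {y | (⟪y, e⟫ : ℝ) = ℓ} = 1) :
    ∃ c : ℝ, 0 < c ∧ ∀ v : Ed d, c * ‖v‖ ≤ ∫ y, |(⟪v, y⟫ : ℝ)| ∂μ := by
  have : Nonempty (Fin d) := ⟨⟨0, hd⟩⟩
  have hcont : Continuous fun v : Ed d => ∫ y, |(⟪v, y⟫ : ℝ)| ∂μ := by
    rw [continuous_iff_continuousAt]
    intro v₀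
    refine continuousAt_of_dominated (bound := fun y => (‖v₀‖ + 1) * ‖y‖)
      (Eventually.of_forall fun v => by fun_prop) ?_ (Integrable.const_mul hμ1 _)
      (ae_of_all _ fun y => by fun_prop)
    filter_upwards [Metric.ball_mem_nhds v₀ one_pos] with v hv
    refine ae_of_all _ fun y => ?_
    have hv' : ‖v‖ ≤ ‖v₀‖ + 1 := by
      have h := norm_sub_norm_le v v₀
      rw [mem_ball_iff_norm] at hv
      linarith
    rw [Real.norm_eq_abs, abs_abs]
    exact (abs_real_inner_le_norm v y).trans (by gcongr)
  obtain ⟨e, he, hmin⟩ := (isCompact_sphere (0 : Ed d) 1).exists_isMinOn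
    (NormedSpace.sphere_nonempty.mpr zero_le_one) hcont.continuousOn
  have he1 : ‖e‖ = 1 := by simpa using he
  refine ⟨∫ y, |(⟪e, y⟫ : ℝ)| ∂μ, ?_, fun v => ?_⟩
  · refine lt_of_le_of_ne (integral_nonneg fun _ => abs_nonneg _) fun h0 => hμ ⟨e, 0, he1, ?_⟩
    have hae := (integral_eq_zero_iff_of_nonneg (fun _ => abs_nonneg _)
      (hμ1.integrable_id.const_inner e).abs).mp h0.symm
    refine (mem_ae_iff_prob_eq_one (measurableSet_eq_fun (by fun_prop) measurable_const)).mp ?_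
    filter_upwards [hae] with y hy
    exact (real_inner_comm _ _).trans (abs_eq_zero.mp hy)
  · rcases eq_or_ne v 0 with rfl | hv
    · simp
    have hv0 : 0 < ‖v‖ := norm_pos_iff.mpr hv
    have hle := hmin (show ‖v‖⁻¹ • v ∈ Metric.sphere (0 : Ed d) 1 by
      simp [norm_smul, hv0.ne'])
    simp only [Set.mem_ofPred_eq, inner_smul_left, abs_mul, integral_const_mul] at hle
    rw [← le_div_iff₀ hv0]
    refine hle.trans_eq ?_
    simp [div_eq_inv_mul]

lemma exists_integral_norm_le_integral_abs_apply {d : ℕ} (hd : 1 ≤ d) {ρ : Measure (Ed d)}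
    (hρ1 : FirstMoment ρ) :
    ∃ i : Fin d, (∫ x, ‖x‖ ∂ρ) / d ≤ ∫ x, |(⟪EuclideanSpace.single i (1 : ℝ), x⟫ : ℝ)| ∂ρ := by
  have : Nonempty (Fin d) := ⟨⟨0, hd⟩⟩
  have hi (i : Fin d) : Integrable
      (fun x : Ed d => |(⟪EuclideanSpace.single i (1 : ℝ), x⟫ : ℝ)|) ρ :=
    (hρ1.integrable_id.const_inner _).abs
  obtain ⟨i, -, h⟩ := Finset.exists_le_of_sum_le (s := Finset.univ)
    (f := fun _ : Fin d => (∫ x, ‖x‖ ∂ρ) / d)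
    (g := fun i => ∫ x, |(⟪EuclideanSpace.single i (1 : ℝ), x⟫ : ℝ)| ∂ρ)
    Finset.univ_nonempty (by
      rw [← integral_finsetSum _ fun i _ => hi i]
      have hd0 : (d : ℝ) ≠ 0 := by positivity
      simp only [Finset.sum_const, Finset.card_univ, Fintype.card_fin, nsmul_eq_mul,
        mul_div_cancel₀ _ hd0]
      refine integral_mono hρ1 (integrable_finsetSum _ fun i _ => hi i) fun x => ?_
      rw [EuclideanSpace.norm_eq, Real.sqrt_le_iff]
      refine ⟨Finset.sum_nonneg fun _ _ => abs_nonneg _, ?_⟩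
      simpa [EuclideanSpace.inner_single_left] using Finset.sum_sq_le_sq_sum_of_nonneg (s := Finset.univ) (f := fun i => |x i|)
        fun i _ => abs_nonneg _)
  exact ⟨i, h⟩

lemma exists_coercive_of_not_hyperplane {d : ℕ} (hd : 1 ≤ d) {μ : Measure (Ed d)}
    [IsProbabilityMeasure μ] (hμ1 : FirstMoment μ) (hμc : Centered μ)
    (hμ : ¬ ∃ e : Ed d, ∃ ℓ : ℝ, ‖e‖ = 1 ∧ μ {y | (⟪y, e⟫ : ℝ) = ℓ} = 1) :
    ∃ c : ℝ, 0 < c ∧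
      ∀ ρ : Measure (Ed d), IsProbabilityMeasure ρ → FirstMoment ρ → Centered ρ →
        ((c * ∫ x, ‖x‖ ∂ρ : ℝ) : EReal) ≤ maxCorr ρ μ := by
  obtain ⟨c, hc, hcv⟩ := exists_pos_mul_norm_le_integral_abs_inner hd hμ1 hμ
  refine ⟨c / (4 * d), by positivity, fun ρ _ hρ1 hρc => ?_⟩
  obtain ⟨i, hi⟩ := exists_integral_norm_le_integral_abs_apply hd hρ1
  obtain ⟨f, hf, hf1, hf0, hfe⟩ := exists_tilt_inner_eq hρ1 hρc (EuclideanSpace.single i 1)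
  obtain ⟨g, hg, hg1, hg0, hge⟩ := exists_tilt_inner_eq hμ1 hμc (∫ x, f x • x ∂ρ)
  refine le_trans ?_ (coe_inner_le_maxCorr hρ1 hμ1 hμc hf hf1 hf0 hg hg1 hg0)
  rw [EReal.coe_le_coe_iff, hge]
  have hnorm : (∫ x, ‖x‖ ∂ρ) / d / 2 ≤ ‖∫ x, f x • x ∂ρ‖ := by
    have h := real_inner_le_norm (EuclideanSpace.single i (1 : ℝ)) (∫ x, f x • x ∂ρ)
    rw [hfe, PiLp.norm_single, norm_one, one_mul] at h
    linarith
  have hd0 : (d : ℝ) ≠ 0 := by positivity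
  calc c / (4 * d) * ∫ x, ‖x‖ ∂ρ = c * ((∫ x, ‖x‖ ∂ρ) / d / 2) / 2 := by
        field_simp
        ring
    _ ≤ c * ‖∫ x, f x • x ∂ρ‖ / 2 := by gcongr
    _ ≤ _ := by gcongr; exact hcv _

lemma ae_inner_eq_zero_of_hyperplane {d : ℕ} {μ : Measure (Ed d)} [IsProbabilityMeasure μ]
    (hμ1 : FirstMoment μ) (hμc : Centered μ) {e : Ed d} {ℓ : ℝ}
    (h : μ {y | (⟪y, e⟫ : ℝ) = ℓ} = 1) : ∀ᵐ y ∂μ, (⟪e, y⟫ : ℝ) = 0 := by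
  have hae : ∀ᵐ y ∂μ, (⟪y, e⟫ : ℝ) = ℓ :=
    (mem_ae_iff_prob_eq_one (measurableSet_eq_fun (by fun_prop) measurable_const)).mpr h
  have hℓ : ℓ = 0 := by
    have h0 := integral_inner (𝕜 := ℝ) hμ1.integrable_id e
    rw [show ∫ y, y ∂μ = 0 from hμc, inner_zero_right] at h0
    rw [← h0]
    calc ℓ = ∫ _, ℓ ∂μ := by simp
      _ = _ := integral_congr_ae (hae.mono fun y hy => by rw [← hy, real_inner_comm])
  filter_upwards [hae] with y hy
  rw [real_inner_comm, hy, hℓ]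

/-- The uniform probability measure on the two points `e` and `-e`. -/
def symmDirac {d : ℕ} (e : Ed d) : Measure (Ed d) :=
  (2⁻¹ : ℝ≥0∞) • (Measure.dirac e + Measure.dirac (-e))

instance {d : ℕ} (e : Ed d) : IsProbabilityMeasure (symmDirac e) :=
  ⟨by simp [symmDirac, ENNReal.inv_two_add_inv_two]⟩

lemma integrable_symmDirac {d : ℕ} {F : Type*} [NormedAddCommGroup F] (e : Ed d)
    (f : Ed d → F) : Integrable f (symmDirac e) := by
  refine Integrable.smul_measure (integrable_add_measure.mpr ⟨?_, ?_⟩) (by simp) <;>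
  exact integrable_dirac (by simp)

lemma integral_symmDirac {d : ℕ} {F : Type*} [NormedAddCommGroup F] [NormedSpace ℝ F]
    [CompleteSpace F] (e : Ed d) (f : Ed d → F) :
    ∫ x, f x ∂(symmDirac e) = (2⁻¹ : ℝ) • (f e + f (-e)) := by
  rw [symmDirac, integral_smul_measure, integral_add_measure, integral_dirac, integral_dirac]
  · simp
  all_goals exact integrable_dirac (by simp)

lemma maxCorr_symmDirac_eq_zero {d : ℕ} {μ : Measure (Ed d)} [IsProbabilityMeasure μ]
    {e : Ed d} (he : ∀ᵐ y ∂μ, (⟪e, y⟫ : ℝ) = 0) : maxCorr (symmDirac e) μ = 0 := by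
  have hpair : ∀ γ ∈ Couplings (symmDirac e) μ, pairInt γ = 0 := by
    rintro γ ⟨_, hfst, hsnd⟩
    have h1 : ∀ᵐ p ∂γ, p.1 = e ∨ p.1 = -e := by
      refine ae_of_ae_map (p := fun x => x = e ∨ x = -e) measurable_fst.aemeasurable ?_
      change ∀ᵐ x ∂γ.fst, x = e ∨ x = -e
      rw [hfst, symmDirac]
      refine Measure.ae_smul_measure (ae_add_measure_iff.mpr ⟨?_, ?_⟩) _ <;>
      simp [ae_dirac_eq]
    have h2 : ∀ᵐ p ∂γ, (⟪e, p.2⟫ : ℝ) = 0 := by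
      refine ae_of_ae_map (p := fun y => (⟪e, y⟫ : ℝ) = 0) measurable_snd.aemeasurable ?_
      change ∀ᵐ y ∂γ.snd, (⟪e, y⟫ : ℝ) = 0
      rwa [hsnd]
    have h0 : (fun p : Ed d × Ed d => (⟪p.1, p.2⟫ : ℝ)) =ᵐ[γ] fun _ => 0 := by
      filter_upwards [h1, h2] with p hp1 hp2
      rcases hp1 with h | h <;> simp [h, hp2]
    rw [pairInt_eq_integral ((integrable_zero _ _ _).congr h0.symm), integral_congr_ae h0]
    simp
  refine le_antisymm (iSup₂_le fun γ hγ => (hpair γ hγ).le) ?_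
  have hmem : (symmDirac e).prod μ ∈ Couplings (symmDirac e) μ :=
    ⟨inferInstance, Measure.fst_prod, Measure.snd_prod⟩
  rw [← hpair _ hmem]
  exact le_iSup₂ (f := fun γ (_ : γ ∈ Couplings (symmDirac e) μ) => pairInt γ) _ hmem

lemma exists_maxCorr_eq_zero_of_hyperplane {d : ℕ} {μ : Measure (Ed d)}
    [IsProbabilityMeasure μ] (hμ1 : FirstMoment μ) (hμc : Centered μ)
    (h : ∃ e : Ed d, ∃ ℓ : ℝ, ‖e‖ = 1 ∧ μ {y | (⟪y, e⟫ : ℝ) = ℓ} = 1) :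
    ∃ ρ : Measure (Ed d), IsProbabilityMeasure ρ ∧ FirstMoment ρ ∧ Centered ρ ∧
      0 < ∫ x, ‖x‖ ∂ρ ∧ maxCorr ρ μ = 0 := by
  obtain ⟨e, ℓ, he, hℓ⟩ := h
  refine ⟨symmDirac e, inferInstance, integrable_symmDirac e _, ?_, ?_,
    maxCorr_symmDirac_eq_zero (ae_inner_eq_zero_of_hyperplane hμ1 hμc hℓ)⟩
  · rw [Centered, integral_symmDirac]
    simp
  · rw [integral_symmDirac, norm_neg, he]
    norm_num

/-- the coercivity inequality `T(ρ,μ) ≥ c ∫|x| dρ` (over centered `ρ ∈ P_1`)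
holds for some `c > 0` iff `μ` is not supported on an affine hyperplane; in particular if `μ`
is supported on a hyperplane there is a centered `ρ` with positive first moment and
`T(ρ,μ) = 0`. -/
theorem maxCorr_coercive_iff_not_hyperplane {d : ℕ} (hd : 1 ≤ d)
    (μ : Measure (Ed d)) [IsProbabilityMeasure μ] (hμ1 : FirstMoment μ) (hμc : Centered μ) :
    ((∃ c : ℝ, 0 < c ∧
        ∀ ρ : Measure (Ed d), IsProbabilityMeasure ρ → FirstMoment ρ → Centered ρ →
          ((c * ∫ x, ‖x‖ ∂ρ : ℝ) : EReal) ≤ maxCorr ρ μ) ↔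
      ¬ ∃ e : Ed d, ∃ ℓ : ℝ, ‖e‖ = 1 ∧ μ {y | (⟪y, e⟫ : ℝ) = ℓ} = 1) ∧
    ((∃ e : Ed d, ∃ ℓ : ℝ, ‖e‖ = 1 ∧ μ {y | (⟪y, e⟫ : ℝ) = ℓ} = 1) →
      ∃ ρ : Measure (Ed d), IsProbabilityMeasure ρ ∧ FirstMoment ρ ∧ Centered ρ ∧
        0 < ∫ x, ‖x‖ ∂ρ ∧ maxCorr ρ μ = 0) := by
  have hdeg := exists_maxCorr_eq_zero_of_hyperplane hμ1 hμc
  refine ⟨⟨?_, exists_coercive_of_not_hyperplane hd hμ1 hμc⟩, hdeg⟩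
  rintro ⟨c, hc, hcoer⟩ hplane
  obtain ⟨ρ, hρ, hρ1, hρc, hpos, hzero⟩ := hdeg hplane
  have h := hcoer ρ hρ hρ1 hρc
  rw [hzero] at h
  exact (mul_pos hc hpos).not_ge (EReal.coe_nonpos.mp h)
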